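/- Let (X,d) be a complete separable metric space in which closed balls are compact, let α be a Young function satisfying the Δ₂-condition, and let μ be a probability measure on X. If μ satisfies the modified log-Sobolev inequality plus LSI⁺_α(A) for some A > 0, then μ satisfies the transport-entropy inequality T_α(1/t_A), where t_A = sup{ t ∈ [0,∞) : ξ_α(t) < 1/A } and ξ_α(x) = sup_{u>0} α*(x·α'₊(u)) / (x·α(u)). -/

import Mathlib

open MeasureTheory Filter Set Topology
open scoped ENNReal NNReal

noncomputable section

/-- The right derivative of a function `α : ℝ → ℝ`. -/
def rightD (α : ℝ → ℝ) (x : ℝ) : ℝ := derivWithin α (Set.Ioi x) x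

/-- The left derivative of a function `α : ℝ → ℝ`. -/
def leftD (α : ℝ → ℝ) (x : ℝ) : ℝ := derivWithin α (Set.Iio x) x

/-- A Young function: an even, convex, nonnegative function, increasing on `[0,∞)`,
vanishing at `0` and with vanishing right derivative at `0`. -/
structure IsYoung (α : ℝ → ℝ) : Prop where
  nonneg : ∀ x, 0 ≤ α x
  even : ∀ x, α (-x) = α x
  convex : ConvexOn ℝ Set.univ α
  mono : StrictMonoOn α (Set.Ici 0)
  zero : α 0 = 0
  rightD_zero : rightD α 0 = 0

/-- The Δ₂-condition for a Young function. -/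
def DeltaTwo (α : ℝ → ℝ) : Prop := ∃ K > 0, ∀ x : ℝ, α (2 * x) ≤ K * α x

/-- `r_α = inf_{x>0} x α'₋(x)/α(x)`. -/
def rAlpha (α : ℝ → ℝ) : ℝ := sInf {r : ℝ | ∃ x > 0, r = x * leftD α x / α x}

/-- `p_α = sup_{x>0} x α'₊(x)/α(x)`. -/
def pAlpha (α : ℝ → ℝ) : ℝ := sSup {r : ℝ | ∃ x > 0, r = x * rightD α x / α x}

/-- The Fenchel-Legendre transform `α*(y) = sup_x {xy - α(x)}`, with values in `[0,∞]`. -/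
def legendre (α : ℝ → ℝ) (y : ℝ) : ℝ≥0∞ := ⨆ x : ℝ, ENNReal.ofReal (x * y - α x)

/-- `ξ_α(t) = sup_{u>0} α*(t α'₊(u)) / (t α(u))`. -/
def xiAlpha (α : ℝ → ℝ) (t : ℝ) : ℝ≥0∞ :=
  ⨆ u : {u : ℝ // 0 < u}, legendre α (t * rightD α u) / ENNReal.ofReal (t * α u)

/-- A bounded real-valued function. -/
def IsBoundedFun {Y : Type*} (f : Y → ℝ) : Prop := ∃ M, ∀ x, |f x| ≤ M

variable {X : Type*} [MetricSpace X] [MeasurableSpace X]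

/-- The optimal transport cost `T_α(ν,μ)` between two measures, for the cost
function `(x,y) ↦ α(d(x,y))`. -/
def transportCost (α : ℝ → ℝ) (ν μ : Measure X) : ℝ≥0∞ :=
  sInf { c : ℝ≥0∞ | ∃ π : Measure (X × X), π.map Prod.fst = ν ∧ π.map Prod.snd = μ ∧
      c = ∫⁻ z, ENNReal.ofReal (α (dist z.1 z.2)) ∂π }

open Classical in
/-- The relative entropy `H(ν|μ) = ∫ log (dν/dμ) dν` if `ν ≪ μ` (and `+∞` if `ν` is not
absolutely continuous with respect to `μ`, or if the integral diverges). -/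
def relEnt (ν μ : Measure X) : ℝ≥0∞ :=
  if ν ≪ μ ∧ Integrable (fun x => Real.log (ν.rnDeriv μ x).toReal) ν
  then ENNReal.ofReal (∫ x, Real.log (ν.rnDeriv μ x).toReal ∂ν) else ⊤

/-- The transport-entropy inequality `T_α(C)`: for every probability measure `ν`,
`T_α(ν,μ) ≤ C H(ν|μ)`. -/
def TransportEntropy (μ : Measure X) (α : ℝ → ℝ) (C : ℝ) : Prop :=
  ∀ ν : Measure X, IsProbabilityMeasure ν →
    transportCost α ν μ ≤ ENNReal.ofReal C * relEnt ν μ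

/-- The entropy functional `Ent_μ(e^f)`. -/
def entExp (μ : Measure X) (f : X → ℝ) : ℝ :=
  ∫ x, Real.exp (f x) * Real.log (Real.exp (f x)) ∂μ
    - (∫ x, Real.exp (f x) ∂μ) * Real.log (∫ x, Real.exp (f x) ∂μ)

/-- `|∇⁺ f|(x) = limsup_{y → x} [f(y) - f(x)]₊ / d(y,x)` (equal to `0` at isolated
points by the conventions on `limsup` and `sInf` in `ℝ`). -/
def gradPlus (f : X → ℝ) (x : X) : ℝ :=
  limsup (fun y => max (f y - f x) 0 / dist y x) (𝓝[≠] x)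

/-- `|∇⁻ f|(x) = limsup_{y → x} [f(y) - f(x)]₋ / d(y,x)` (equal to `0` at isolated
points by the conventions on `limsup` and `sInf` in `ℝ`). -/
def gradMinus (f : X → ℝ) (x : X) : ℝ :=
  limsup (fun y => max (-(f y - f x)) 0 / dist y x) (𝓝[≠] x)

/-- The modified log-Sobolev inequality plus `LSI⁺_α(A)`. -/
def LSIplus (μ : Measure X) (α : ℝ → ℝ) (A : ℝ) : Prop :=
  ∀ f : X → ℝ, IsBoundedFun f → LocallyLipschitz f →
    ENNReal.ofReal (entExp μ f) ≤
      ENNReal.ofReal A * ∫⁻ x, legendre α (gradPlus f x) * ENNReal.ofReal (Real.exp (f x)) ∂μ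

/-- The modified log-Sobolev inequality minus `LSI⁻_α(A)`. -/
def LSIminus (μ : Measure X) (α : ℝ → ℝ) (A : ℝ) : Prop :=
  ∀ f : X → ℝ, IsBoundedFun f → LocallyLipschitz f →
    ENNReal.ofReal (entExp μ f) ≤
      ENNReal.ofReal A * ∫⁻ x, legendre α (gradMinus f x) * ENNReal.ofReal (Real.exp (f x)) ∂μ

/-- The inf-convolution operator `Q_α^λ f(x) = inf_y {f(y) + λ α(d(x,y))}`. -/
def QInf (α : ℝ → ℝ) (lam : ℝ) (f : X → ℝ) (x : X) : ℝ :=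
  ⨅ y : X, (f y + lam * α (dist x y))

/-- The `(τ)`-log-Sobolev inequality `(τ)-LSI_α(λ, A)`. -/
def TauLSI (μ : Measure X) (α : ℝ → ℝ) (lam A : ℝ) : Prop :=
  ∀ f : X → ℝ, IsBoundedFun f → LocallyLipschitz f →
    entExp μ f ≤ A * ∫ x, (f x - QInf α lam f x) * Real.exp (f x) ∂μ

/-- The `n`-dimensional inf-convolution operator
`Q_{α,n} f(x) = inf_y {f(y) + Σᵢ α(d(xᵢ,yᵢ))}`. -/
def QInfN (α : ℝ → ℝ) {n : ℕ} (f : (Fin n → X) → ℝ) (x : Fin n → X) : ℝ :=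
  ⨅ y : Fin n → X, (f y + ∑ i, α (dist (x i) (y i)))

/-- The `n`-dimensional sup-convolution operator
`P_{α,n} f(x) = sup_y {f(y) - Σᵢ α(d(xᵢ,yᵢ))}`. -/
def PSupN (α : ℝ → ℝ) {n : ℕ} (f : (Fin n → X) → ℝ) (x : Fin n → X) : ℝ :=
  ⨆ y : Fin n → X, (f y - ∑ i, α (dist (x i) (y i)))

end



namespace IsYoung

variable {α : ℝ → ℝ}

theorem continuous (hα : IsYoung α) : Continuous α :=
  continuousOn_univ.1 (hα.convex.continuousOn isOpen_univ)

theorem le_of_le (hα : IsYoung α) {x y : ℝ} (hx : 0 ≤ x) (hxy : x ≤ y) : α x ≤ α y :=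
  hα.mono.monotoneOn hx (hx.trans hxy) hxy

theorem pos (hα : IsYoung α) {x : ℝ} (hx : 0 < x) : 0 < α x := by
  have := hα.mono (Set.self_mem_Ici) hx.le hx
  rwa [hα.zero] at this

theorem abs_apply (hα : IsYoung α) (x : ℝ) : α |x| = α x := by
  rcases abs_choice x with h | h <;> rw [h]
  exact hα.even x

theorem hasDerivWithinAt (hα : IsYoung α) (x : ℝ) :
    HasDerivWithinAt α (rightD α x) (Set.Ioi x) x :=
  hα.convex.hasDerivWithinAt_rightDeriv_of_mem_interior (by simp)

theorem rightD_mono (hα : IsYoung α) : Monotone (rightD α) := by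
  have := hα.convex.monotoneOn_rightDeriv
  rw [interior_univ] at this
  exact monotoneOn_univ.1 this

theorem rightD_nonneg (hα : IsYoung α) {x : ℝ} (hx : 0 ≤ x) : 0 ≤ rightD α x :=
  hα.rightD_zero ▸ hα.rightD_mono hx

/-- The right derivative is a subgradient. -/
theorem add_rightD_mul_le (hα : IsYoung α) (x y : ℝ) :
    α x + rightD α x * (y - x) ≤ α y := by
  rcases lt_trichotomy x y with h | h | h
  · have := hα.convex.rightDeriv_le_slope_of_mem_interior (x := x) (y := y)
      (by simp) (mem_univ _) h
    rw [slope_def_field, le_div_iff₀ (sub_pos.2 h)] at this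
    change rightD α x * (y - x) ≤ _ at this
    linarith
  · simp [h]
  · have h1 := hα.convex.slope_le_leftDeriv_of_mem_interior (x := y) (y := x)
      (mem_univ _) (by simp) h
    have h2 := h1.trans (hα.convex.leftDeriv_le_rightDeriv_of_mem_interior (x := x) (by simp))
    rw [slope_def_field, div_le_iff₀ (sub_pos.2 h)] at h2
    change _ ≤ rightD α x * (x - y) at h2
    linarith

theorem le_mul_rightD (hα : IsYoung α) (x : ℝ) : α x ≤ x * rightD α x := by
  have := hα.add_rightD_mul_le x 0
  rw [hα.zero] at this
  linarith

theorem tendsto_atTop (hα : IsYoung α) : Tendsto α atTop atTop := by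
  have h1 : 0 < rightD α 1 := by
    have := hα.le_mul_rightD 1
    linarith [hα.pos one_pos]
  refine tendsto_atTop_mono (fun y => hα.add_rightD_mul_le 1 y) ?_
  exact tendsto_atTop_add_const_left _ _
    ((tendsto_atTop_add_const_right _ (-1) tendsto_id).const_mul_atTop h1)

theorem legendre_zero (hα : IsYoung α) : legendre α 0 = 0 := by
  simp [legendre, hα.nonneg]

theorem legendre_mono (hα : IsYoung α) {y z : ℝ} (hy : 0 ≤ y) (hyz : y ≤ z) :
    legendre α y ≤ legendre α z := by
  refine iSup_le fun x => le_iSup_of_le |x| (ENNReal.ofReal_le_ofReal ?_)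
  rw [hα.abs_apply]
  have h1 : x * y ≤ |x| * y := mul_le_mul_of_nonneg_right (le_abs_self x) hy
  have h2 : |x| * y ≤ |x| * z := mul_le_mul_of_nonneg_left hyz (abs_nonneg x)
  linarith

theorem legendre_mul_rightD_le (hα : IsYoung α) {t c : ℝ} (ht : 0 < t)
    (hξ : xiAlpha α t ≤ ENNReal.ofReal c) {u : ℝ} (hu : 0 ≤ u) :
    legendre α (t * rightD α u) ≤ ENNReal.ofReal c * ENNReal.ofReal (t * α u) := by
  rcases hu.eq_or_lt with rfl | hu
  · simp [hα.rightD_zero, hα.legendre_zero]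
  · have h1 := (le_iSup (fun u : {u : ℝ // 0 < u} =>
      legendre α (t * rightD α u) / ENNReal.ofReal (t * α u)) ⟨u, hu⟩).trans hξ
    have h2 : 0 < t * α u := mul_pos ht (hα.pos hu)
    exact (ENNReal.div_le_iff (by simpa using h2) ENNReal.ofReal_ne_top).1 h1

theorem le_of_xiAlpha_le (hα : IsYoung α) {t c : ℝ} (ht : 0 < t) (hc : 0 ≤ c)
    (hξ : xiAlpha α t ≤ ENNReal.ofReal c) : t ≤ α (c + 1) / α 1 := by
  have h1 := (le_iSup (fun x : ℝ => ENNReal.ofReal (x * (t * rightD α 1) - α x)) (c + 1)).trans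
    (hα.legendre_mul_rightD_le ht hξ zero_le_one)
  have hp := hα.pos one_pos
  rw [← ENNReal.ofReal_mul hc, ENNReal.ofReal_le_ofReal_iff (by positivity)] at h1
  have h2 : (c + 1) * (t * α 1) ≤ (c + 1) * (t * rightD α 1) := by
    have := hα.le_mul_rightD 1
    rw [one_mul] at this
    gcongr
  rw [le_div_iff₀ hp]
  linarith

/-- Under the `Δ₂`-condition, `ξ_α` vanishes at `0⁺`. -/
theorem exists_xiAlpha_le (hα : IsYoung α) (hΔ : DeltaTwo α) {ε : ℝ} (hε : 0 < ε) :
    ∃ t > 0, xiAlpha α t ≤ ENNReal.ofReal ε := by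
  obtain ⟨K, hK0, hK⟩ := hΔ
  have hK1 : 1 ≤ K := by
    have h1 := hK 1
    have h2 := hα.le_of_le zero_le_one (show (1 : ℝ) ≤ 2 * 1 by norm_num)
    have h3 := hα.pos one_pos
    by_contra! h
    nlinarith
  have hpow : ∀ (n : ℕ) (x : ℝ), α x ≤ K ^ n * α ((1 / 2) ^ n * x) := by
    intro n
    induction n with
    | zero => intro x; simp
    | succ n ih =>
      intro x
      refine (ih x).trans ?_
      have h := hK ((1 / 2) ^ (n + 1) * x)
      rw [show 2 * ((1 / 2 : ℝ) ^ (n + 1) * x) = (1 / 2) ^ n * x by ring] at h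
      calc K ^ n * α ((1 / 2) ^ n * x) ≤ K ^ n * (K * α ((1 / 2) ^ (n + 1) * x)) := by gcongr
        _ = _ := by ring
  obtain ⟨n, hn⟩ := exists_pow_lt_of_lt_one (show 0 < ε / K by positivity)
    (show (1 / 2 : ℝ) < 1 by norm_num)
  refine ⟨1 / K ^ (n + 1), by positivity, iSup_le fun ⟨u, hu⟩ => ?_⟩
  set t := 1 / K ^ (n + 1) with ht
  have ht0 : 0 < t := by positivity
  have hαu := hα.pos hu
  have hd : u * rightD α u ≤ K * α u := by
    have h1 := hα.add_rightD_mul_le u (2 * u)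
    have h2 := hK u
    linarith
  have hd0 := hα.rightD_nonneg hu.le
  have htK : t * (K * α u) = α u / K ^ n := by
    rw [ht, pow_succ]; field_simp
  have htu : α u / K ^ n ≤ α u := div_le_self hαu.le (one_le_pow₀ hK1)
  have ht1 : t ≤ 1 := by
    rw [ht]; exact div_le_one_of_le₀ (one_le_pow₀ hK1) (by positivity)
  refine ENNReal.div_le_of_le_mul (iSup_le fun x => ?_)
  rw [← ENNReal.ofReal_mul hε.le]
  refine ENNReal.ofReal_le_ofReal ?_
  have hR : 0 ≤ ε * (t * α u) := by positivity
  have hαx := hα.nonneg x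
  have htd : 0 ≤ t * rightD α u := by positivity
  rcases le_or_gt x ((1 / 2) ^ n * u) with hx | hx
  · have h1 : x * (t * rightD α u) ≤ ε / K * u * (t * rightD α u) := by
      refine mul_le_mul_of_nonneg_right (hx.trans ?_) htd
      gcongr
    have h2 : ε / K * u * (t * rightD α u) ≤ ε / K * t * (K * α u) := by
      calc _ = ε / K * t * (u * rightD α u) := by ring
        _ ≤ _ := by gcongr
    have h3 : ε / K * t * (K * α u) = ε * (t * α u) := by field_simp
    linarith
  · have hmono : α u / K ^ n ≤ α x := by
      rw [div_le_iff₀' (by positivity)]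
      refine (hpow n u).trans ?_
      have := hα.le_of_le (by positivity) hx.le
      gcongr
    rcases le_or_gt x u with hxu | hxu
    · have h1 : x * (t * rightD α u) ≤ t * (K * α u) := by
        calc x * (t * rightD α u) ≤ u * (t * rightD α u) := by gcongr
          _ = t * (u * rightD α u) := by ring
          _ ≤ _ := by gcongr
      linarith
    · have h1 := hα.add_rightD_mul_le u x
      have h2 : t * (rightD α u * (x - u)) ≤ 1 * (rightD α u * (x - u)) :=
        mul_le_mul_of_nonneg_right ht1 (mul_nonneg hd0 (by linarith))
      have h3 : t * (u * rightD α u) ≤ t * (K * α u) := by gcongr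
      nlinarith

end IsYoung

section Kantorovich

open BoundedContinuousFunction CompactlySupported

variable {X : Type*} [MetricSpace X]

/-- The radial cutoff equal to `1` on the ball of radius `n` around `o` and vanishing outside the
ball of radius `n + 1`. -/
def radialCutoff (o : X) (n : ℕ) (x : X) : ℝ := max 0 (min 1 (n + 1 - dist x o))

theorem radialCutoff_nonneg (o : X) (n : ℕ) (x : X) : 0 ≤ radialCutoff o n x := le_max_left _ _

theorem radialCutoff_le_one (o : X) (n : ℕ) (x : X) : radialCutoff o n x ≤ 1 :=
  max_le zero_le_one (min_le_left _ _)

@[fun_prop]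
theorem continuous_radialCutoff (o : X) (n : ℕ) : Continuous (radialCutoff o n) := by
  unfold radialCutoff; fun_prop

theorem radialCutoff_mono (o : X) (x : X) : Monotone fun n => radialCutoff o n x := by
  intro m n h
  have : (m : ℝ) ≤ n := by exact_mod_cast h
  simp only [radialCutoff]
  gcongr

theorem radialCutoff_eq_one {o : X} {n : ℕ} {x : X} (h : dist x o ≤ n) :
    radialCutoff o n x = 1 := by
  rw [radialCutoff, min_eq_left (by linarith), max_eq_right zero_le_one]

theorem tendsto_radialCutoff (o : X) (x : X) :
    Tendsto (fun n => radialCutoff o n x) atTop (𝓝 1) := by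
  obtain ⟨N, hN⟩ := exists_nat_ge (dist x o)
  refine tendsto_const_nhds.congr' ?_
  filter_upwards [eventually_ge_atTop N] with n hn
  exact (radialCutoff_eq_one (hN.trans (by exact_mod_cast hn))).symm

theorem radialCutoff_eq_zero {o : X} {n : ℕ} {x : X} (h : x ∉ Metric.closedBall o (n + 1)) :
    radialCutoff o n x = 0 := by
  rw [Metric.mem_closedBall, not_le] at h
  exact max_eq_left ((min_le_right _ _).trans (by linarith))

/-- Hahn-Banach part of the Kantorovich duality: if every admissible pair of potentials has dual
value at most `B`, there is a positive functional on `C_c(X × X)` which is compatible with the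
marginals `ν`, `μ` and bounded by `B` on functions dominated by the cost. -/
theorem exists_functional_of_dual_le [MeasurableSpace X] [BorelSpace X] (ν μ : Measure X)
    [IsProbabilityMeasure ν] [IsProbabilityMeasure μ] (c : X × X → ℝ) (B : ℝ)
    (hB : ∀ g h : X →ᵇ ℝ, (∀ x y, g x + h y ≤ c (x, y)) →
      ∫ x, g x ∂ν + ∫ y, h y ∂μ ≤ B) :
    ∃ Λ : C_c(X × X, ℝ) →ₗ[ℝ] ℝ, ∀ (g h : X →ᵇ ℝ) (s : ℝ) (φ : C_c(X × X, ℝ)), 0 ≤ s →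
      (∀ x y, 0 ≤ g x + h y + s * c (x, y) + φ (x, y)) →
      0 ≤ ∫ x, g x ∂ν + ∫ y, h y ∂μ + s * B + Λ φ := by
  let E := ((X →ᵇ ℝ) × (X →ᵇ ℝ) × ℝ)
  let cone : PointedCone ℝ (E × C_c(X × X, ℝ)) :=
    { carrier := {p | 0 ≤ p.1.2.2 ∧
        ∀ x y, 0 ≤ p.1.1 x + p.1.2.1 y + p.1.2.2 * c (x, y) + p.2 (x, y)}
      add_mem' := by
        rintro p q ⟨hp, hp'⟩ ⟨hq, hq'⟩
        refine ⟨add_nonneg hp hq, fun x y => (add_nonneg (hp' x y) (hq' x y)).trans_eq ?_⟩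
        change _ = (p.1.1 x + q.1.1 x) + (p.1.2.1 y + q.1.2.1 y) +
          (p.1.2.2 + q.1.2.2) * c (x, y) + (p.2 (x, y) + q.2 (x, y))
        ring
      zero_mem' := by simp
      smul_mem' := by
        rintro ⟨r, hr⟩ p ⟨hp, hp'⟩
        refine ⟨mul_nonneg hr hp, fun x y => (mul_nonneg hr (hp' x y)).trans_eq ?_⟩
        change _ = r * p.1.1 x + r * p.1.2.1 y + (r * p.1.2.2) * c (x, y) + r * p.2 (x, y)
        ring }
  have hint : ∀ (ρ : Measure X) [IsProbabilityMeasure ρ] (g : X →ᵇ ℝ), Integrable g ρ :=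
    fun ρ _ g => g.integrable ρ
  let ℓ : E →ₗ[ℝ] ℝ :=
    { toFun := fun p => ∫ x, p.1 x ∂ν + ∫ y, p.2.1 y ∂μ + p.2.2 * B
      map_add' := by
        intro p q
        change ∫ x, (p.1 x + q.1 x) ∂ν + ∫ y, (p.2.1 y + q.2.1 y) ∂μ + (p.2.2 + q.2.2) * B = _
        rw [integral_add (hint _ _) (hint _ _), integral_add (hint _ _) (hint _ _)]
        ring
      map_smul' := by
        intro r p
        change ∫ x, r * p.1 x ∂ν + ∫ y, r * p.2.1 y ∂μ + r * p.2.2 * B =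
          r * (∫ x, p.1 x ∂ν + ∫ y, p.2.1 y ∂μ + p.2.2 * B)
        simp only [integral_const_mul]
        ring }
  let f : (E × C_c(X × X, ℝ)) →ₗ.[ℝ] ℝ :=
    ⟨Submodule.prod ⊤ ⊥, ℓ ∘ₗ LinearMap.fst ℝ E _ ∘ₗ Submodule.subtype _⟩
  have hnonneg : ∀ x : f.domain, (x : E × C_c(X × X, ℝ)) ∈ cone → 0 ≤ f x := by
    rintro ⟨⟨⟨g, h, s⟩, φ⟩, hp⟩ ⟨hs, hx⟩
    obtain rfl : φ = 0 := by simpa using hp.2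
    change 0 ≤ ∫ x, g x ∂ν + ∫ y, h y ∂μ + s * B
    simp only [CompactlySupportedContinuousMap.coe_zero, Pi.zero_apply, add_zero] at hs hx
    rcases hs.eq_or_lt with rfl | hs
    · simp only [zero_mul, add_zero] at hx ⊢
      have h1 : ∀ x, 0 ≤ g x + ∫ y, h y ∂μ := fun x => by
        have := integral_nonneg (μ := μ) (f := fun y => g x + h y) (hx x)
        rwa [integral_add (integrable_const _) (hint μ h), integral_const, probReal_univ,
          one_smul] at this
      have := integral_nonneg (μ := ν) (f := fun x => g x + ∫ y, h y ∂μ) h1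
      rwa [integral_add (hint ν g) (integrable_const _), integral_const, probReal_univ,
          one_smul] at this
    · have := hB (-(s⁻¹ • g)) (-(s⁻¹ • h)) fun x y => by
        have := hx x y
        simp only [BoundedContinuousFunction.coe_neg, BoundedContinuousFunction.coe_smul,
          Pi.neg_apply, smul_eq_mul]
        have h2 : 0 ≤ s⁻¹ * (g x + h y + s * c (x, y)) := by positivity
        have h3 : s⁻¹ * (s * c (x, y)) = c (x, y) := by field_simp
        linarith
      simp only [BoundedContinuousFunction.coe_neg, BoundedContinuousFunction.coe_smul,
          Pi.neg_apply, smul_eq_mul, integral_neg, integral_const_mul] at this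
      have h2 := mul_le_mul_of_nonneg_left this hs.le
      have h3 : ∀ a : ℝ, s * (s⁻¹ * a) = a := fun a => by field_simp
      have h4 := h3 (∫ x, g x ∂ν)
      have h5 := h3 (∫ x, h x ∂μ)
      linarith
  have hdense : ∀ y, ∃ x : f.domain, (x : E × C_c(X × X, ℝ)) + y ∈ cone := by
    rintro ⟨⟨g, h, s⟩, φ⟩
    obtain ⟨C, hC⟩ := φ.continuous.bounded_above_of_compact_support φ.hasCompactSupport
    refine ⟨⟨⟨⟨-g + const X C, -h, -s⟩, 0⟩, by simp [f]⟩, ?_, fun x y => ?_⟩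
    · exact (neg_add_cancel s).ge
    · have := (abs_le.1 (hC (x, y))).1
      change -C ≤ φ (x, y) at this
      change 0 ≤ (-g x + C + g x) + (-h y + h y) + (-s + s) * c (x, y) + (0 + φ (x, y))
      rw [neg_add_cancel s, zero_mul]
      linarith
  obtain ⟨G, hG, hGs⟩ := riesz_extension cone f hnonneg hdense
  refine ⟨G ∘ₗ LinearMap.inr ℝ E _, fun g h s φ hs hφ => ?_⟩
  have h1 := hGs ((g, h, s), φ) ⟨hs, hφ⟩
  have h2 := hG ⟨((g, h, s), 0), by simp [f]⟩
  have h3 : (((g, h, s), φ) : E × C_c(X × X, ℝ)) = ((g, h, s), 0) + (0, φ) := by simp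
  rw [h3, map_add, h2] at h1
  exact h1

variable [ProperSpace X]

/-- A continuous function on `X × X` multiplied by the product of two radial cutoffs. -/
def cutoffProd (o : X) (n : ℕ) (F : X × X → ℝ) (hF : Continuous F) : C_c(X × X, ℝ) where
  toFun z := F z * (radialCutoff o n z.1 * radialCutoff o n z.2)
  continuous_toFun := by fun_prop
  hasCompactSupport' := by
    refine HasCompactSupport.intro ((isCompact_closedBall o (n + 1)).prod
      (isCompact_closedBall o (n + 1))) fun z hz => ?_
    rw [Set.mem_prod, not_and_or] at hz
    rcases hz with h | h <;> simp [radialCutoff_eq_zero h]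

theorem cutoffProd_apply (o : X) (n : ℕ) (F : X × X → ℝ) (hF : Continuous F) (z : X × X) :
    cutoffProd o n F hF z = F z * (radialCutoff o n z.1 * radialCutoff o n z.2) := rfl

theorem cutoffProd_nonneg (o : X) (n : ℕ) {F : X × X → ℝ} (hF : Continuous F)
    (h0 : ∀ z, 0 ≤ F z) (z : X × X) : 0 ≤ cutoffProd o n F hF z :=
  mul_nonneg (h0 z) (mul_nonneg (radialCutoff_nonneg _ _ _) (radialCutoff_nonneg _ _ _))

theorem cutoffProd_le (o : X) (n : ℕ) {F : X × X → ℝ} (hF : Continuous F)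
    (h0 : ∀ z, 0 ≤ F z) (z : X × X) : cutoffProd o n F hF z ≤ F z :=
  mul_le_of_le_one_right (h0 z) (mul_le_one₀ (radialCutoff_le_one _ _ _)
    (radialCutoff_nonneg _ _ _) (radialCutoff_le_one _ _ _))

variable [MeasurableSpace X] [BorelSpace X]

theorem lintegral_ofReal_le_of_cutoffProd (o : X) (π : Measure (X × X))
    [IsFiniteMeasureOnCompacts π] {F : X × X → ℝ} (hF : Continuous F) (h0 : ∀ z, 0 ≤ F z) {b : ℝ}
    (hb : ∀ n, ∫ z, cutoffProd o n F hF z ∂π ≤ b) :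
    ∫⁻ z, ENNReal.ofReal (F z) ∂π ≤ ENNReal.ofReal b := by
  have hlim : Tendsto (fun n => ∫⁻ z, ENNReal.ofReal (cutoffProd o n F hF z) ∂π) atTop
      (𝓝 (∫⁻ z, ENNReal.ofReal (F z) ∂π)) := by
    refine lintegral_tendsto_of_tendsto_of_monotone
      (fun n => ((cutoffProd o n F hF).continuous.measurable.ennreal_ofReal).aemeasurable)
      (ae_of_all _ fun z m n h => ENNReal.ofReal_le_ofReal ?_) (ae_of_all _ fun z => ?_)
    · simp only [cutoffProd_apply]
      have h1 := radialCutoff_mono o z.1 h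
      have h2 := radialCutoff_mono o z.2 h
      have h3 := radialCutoff_nonneg o m z.2
      have h4 := radialCutoff_nonneg o n z.1
      have h5 := h0 z
      dsimp only at h1 h2
      gcongr
    · refine ENNReal.tendsto_ofReal ?_
      simpa [cutoffProd_apply] using
        ((tendsto_radialCutoff o z.1).mul (tendsto_radialCutoff o z.2)).const_mul (F z)
  refine le_of_tendsto' hlim fun n => ?_
  have hint : Integrable (fun z => cutoffProd o n F hF z) π :=
    (cutoffProd o n F hF).continuous.integrable_of_hasCompactSupport
      (cutoffProd o n F hF).hasCompactSupport
  rw [← ofReal_integral_eq_lintegral_ofReal hint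
    (ae_of_all _ (cutoffProd_nonneg o n hF h0))]
  exact ENNReal.ofReal_le_ofReal (hb n)

/-- Kantorovich duality for a continuous cost on a proper metric space. -/
theorem exists_coupling_of_dual_le (ν μ : Measure X) [IsProbabilityMeasure ν]
    [IsProbabilityMeasure μ] {c : X × X → ℝ} (hc : Continuous c) (hc0 : ∀ z, 0 ≤ c z) (B : ℝ)
    (hB : ∀ g h : X →ᵇ ℝ, (∀ x y, g x + h y ≤ c (x, y)) →
      ∫ x, g x ∂ν + ∫ y, h y ∂μ ≤ B) :
    ∃ π : Measure (X × X), π.map Prod.fst = ν ∧ π.map Prod.snd = μ ∧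
      ∫⁻ z, ENNReal.ofReal (c z) ∂π ≤ ENNReal.ofReal B := by
  obtain ⟨o⟩ : Nonempty X := nonempty_of_isProbabilityMeasure ν
  obtain ⟨Λ, hΛ⟩ := exists_functional_of_dual_le ν μ c B hB
  have hpos : ∀ φ : C_c(X × X, ℝ), 0 ≤ φ → 0 ≤ Λ φ := fun φ hφ => by
    simpa using hΛ 0 0 0 φ le_rfl (fun x y => by simpa using hφ (x, y))
  have hle : ∀ (g h : X →ᵇ ℝ) (s : ℝ) (φ : C_c(X × X, ℝ)), 0 ≤ s →
      (∀ x y, φ (x, y) ≤ g x + h y + s * c (x, y)) →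
      Λ φ ≤ ∫ x, g x ∂ν + ∫ y, h y ∂μ + s * B := fun g h s φ hs hφ => by
    have := hΛ g h s (-φ) hs fun x y => by
      have := hφ x y
      simp only [CompactlySupportedContinuousMap.coe_neg, Pi.neg_apply]
      linarith
    rw [map_neg] at this
    linarith
  let Λ' : C_c(X × X, ℝ) →ₚ[ℝ] ℝ := PositiveLinearMap.mk₀ Λ hpos
  let π := RealRMK.rieszMeasure Λ'
  have hπ : ∀ φ : C_c(X × X, ℝ), ∫ z, φ z ∂π = Λ φ := fun φ => RealRMK.integral_rieszMeasure Λ' φ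
  have hmass_le : π univ ≤ 1 := by
    have := lintegral_ofReal_le_of_cutoffProd o π (F := fun _ => 1) continuous_const
      (fun _ => zero_le_one) (b := 1) fun n => by
        rw [hπ]
        refine (hle 1 0 0 _ le_rfl fun x y => ?_).trans_eq (by simp)
        simpa using cutoffProd_le o n (F := fun _ => 1) continuous_const
          (fun _ => zero_le_one) (x, y)
    simpa using this
  have : IsFiniteMeasure π := ⟨hmass_le.trans_lt ENNReal.one_lt_top⟩
  have hmass : 1 ≤ π.real univ := by
    have hlim : ∀ ρ : Measure X, IsProbabilityMeasure ρ →
        Tendsto (fun n => ∫ x, radialCutoff o n x ∂ρ) atTop (𝓝 1) := fun ρ _ => by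
      have := tendsto_integral_of_dominated_convergence (μ := ρ)
        (F := fun n x => radialCutoff o n x) (f := fun _ => 1) (fun _ => 1)
        (fun n => (continuous_radialCutoff o n).aestronglyMeasurable) (integrable_const _)
        (fun n => ae_of_all _ fun x => by
          rw [Real.norm_of_nonneg (radialCutoff_nonneg _ _ _)]; exact radialCutoff_le_one _ _ _)
        (ae_of_all _ fun x => tendsto_radialCutoff o x)
      simpa using this
    have hlow : ∀ n, ∫ x, radialCutoff o n x ∂ν + ∫ y, radialCutoff o n y ∂μ - 1 ≤
        π.real univ := fun n => by
      let χ : X →ᵇ ℝ := BoundedContinuousFunction.ofNormedAddCommGroup (radialCutoff o n)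
        (continuous_radialCutoff o n) 1 fun x => by
          rw [Real.norm_of_nonneg (radialCutoff_nonneg _ _ _)]; exact radialCutoff_le_one _ _ _
      have h1 := hΛ (1 - χ) (-χ) 0 (cutoffProd o n (fun _ => 1) continuous_const) le_rfl
        fun x y => by
          change 0 ≤ 1 - radialCutoff o n x + -radialCutoff o n y + 0 * c (x, y) +
            1 * (radialCutoff o n x * radialCutoff o n y)
          nlinarith [radialCutoff_le_one o n x, radialCutoff_le_one o n y]
      rw [← hπ] at h1
      have h2 : ∫ z, cutoffProd o n (fun _ => 1) continuous_const z ∂π ≤ ∫ _, (1 : ℝ) ∂π :=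
        integral_mono ((cutoffProd o n _ _).continuous.integrable_of_hasCompactSupport
          (cutoffProd o n _ _).hasCompactSupport) (integrable_const _)
          fun z => cutoffProd_le o n (F := fun _ => 1) continuous_const (fun _ => zero_le_one) z
      have h3 : ∫ x, (1 - χ) x ∂ν = 1 - ∫ x, radialCutoff o n x ∂ν := by
        change ∫ x, (1 - χ x) ∂ν = _
        rw [integral_sub (integrable_const _) (χ.integrable ν)]
        simp [χ]
      have h4 : ∫ x, (-χ) x ∂μ = - ∫ x, radialCutoff o n x ∂μ := by
        rw [← integral_neg]; rfl
      rw [h3, h4] at h1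
      simp only [integral_const, smul_eq_mul, mul_one] at h2
      linarith
    have := ((hlim ν inferInstance).add (hlim μ inferInstance)).sub_const 1
    have := le_of_tendsto' this hlow
    linarith
  have hreal : π.real univ = 1 :=
    le_antisymm (by simpa [Measure.real] using ENNReal.toReal_mono ENNReal.one_ne_top hmass_le)
      hmass
  -- a marginal dominated by a probability measure on nonnegative functions equals that measure
  have hmarg : ∀ (ρ : Measure X) (_ : IsProbabilityMeasure ρ) (pr : X × X → X) (_ : Continuous pr),
      (∀ (g : X →ᵇ ℝ), (∀ x, 0 ≤ g x) → ∀ n,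
        Λ (cutoffProd o n (fun z => g (pr z)) (by fun_prop)) ≤ ∫ x, g x ∂ρ) →
      π.map pr = ρ := by
    intro ρ _ pr hpr h
    have hmeas := hpr.measurable
    have hint : ∀ g : X →ᵇ ℝ, Integrable (fun z => g (pr z)) π := fun g =>
      (g.compContinuous ⟨pr, hpr⟩).integrable π
    have key : ∀ g : X →ᵇ ℝ, (∀ x, 0 ≤ g x) → ∫ z, g (pr z) ∂π ≤ ∫ x, g x ∂ρ := by
      intro g hg
      have := lintegral_ofReal_le_of_cutoffProd o π (F := fun z => g (pr z)) (by fun_prop)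
        (fun z => hg _) (b := ∫ x, g x ∂ρ) fun n => by rw [hπ]; exact h g hg n
      rwa [← ofReal_integral_eq_lintegral_ofReal (hint g) (ae_of_all _ fun z => hg _),
        ENNReal.ofReal_le_ofReal_iff (integral_nonneg hg)] at this
    have key2 : ∀ g : X →ᵇ ℝ, ∫ z, g (pr z) ∂π ≤ ∫ x, g x ∂ρ := by
      intro g
      have := key (g + const X ‖g‖) fun x => by
        have := (abs_le.1 (g.norm_coe_le_norm x)).1
        simp only [BoundedContinuousFunction.coe_add, Pi.add_apply, const_apply]
        linarith
      simp only [BoundedContinuousFunction.coe_add, Pi.add_apply, const_apply] at this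
      rw [integral_add (hint g) (integrable_const _),
        integral_add (g.integrable ρ) (integrable_const _)] at this
      simpa [hreal] using this
    have : IsFiniteMeasure (π.map pr) := Measure.isFiniteMeasure_map π pr
    refine ext_of_forall_integral_eq_of_IsFiniteMeasure fun g => ?_
    rw [integral_map hmeas.aemeasurable g.continuous.aestronglyMeasurable]
    refine le_antisymm (key2 g) ?_
    have := key2 (-g)
    simp only [BoundedContinuousFunction.coe_neg, Pi.neg_apply, integral_neg] at this
    linarith
  refine ⟨π, hmarg ν inferInstance _ continuous_fst fun g hg n => ?_,
    hmarg μ inferInstance _ continuous_snd fun g hg n => ?_, ?_⟩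
  · refine (hle g 0 0 _ le_rfl fun x y => ?_).trans_eq (by simp)
    simpa using cutoffProd_le o n (F := fun z => g z.1) (by fun_prop) (fun z => hg _) (x, y)
  · refine (hle 0 g 0 _ le_rfl fun x y => ?_).trans_eq (by simp)
    simpa using cutoffProd_le o n (F := fun z => g z.2) (by fun_prop) (fun z => hg _) (x, y)
  · refine lintegral_ofReal_le_of_cutoffProd o π hc hc0 fun n => ?_
    rw [hπ]
    refine (hle 0 0 1 _ zero_le_one fun x y => ?_).trans_eq (by simp)
    simpa using cutoffProd_le o n hc hc0 (x, y)

end Kantorovich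

section InfConvolution

variable {X : Type*} [MetricSpace X] {α : ℝ → ℝ} {t M : ℝ} {g : X → ℝ}

theorem QInf_le (hα : IsYoung α) (ht : 0 ≤ t) (hM : ∀ x, |g x| ≤ M) (x y : X) :
    QInf α t g x ≤ g y + t * α (dist x y) := by
  refine ciInf_le ⟨-M, ?_⟩ y
  rintro _ ⟨z, rfl⟩
  have := (abs_le.1 (hM z)).1
  have := mul_nonneg ht (hα.nonneg (dist x z))
  dsimp only
  linarith

theorem exists_QInf_eq [ProperSpace X] (hα : IsYoung α) (ht : 0 < t) (hg : Continuous g)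
    (hM : ∀ x, |g x| ≤ M) (x : X) : ∃ y, QInf α t g x = g y + t * α (dist x y) := by
  have : Nonempty X := ⟨x⟩
  have hc := hα.continuous
  have hcont : Continuous fun y => g y + t * α (dist x y) := by fun_prop
  obtain ⟨y, hy⟩ := hcont.exists_forall_le <|
    tendsto_atTop_mono (fun y => add_le_add_left (abs_le.1 (hM y)).1 (t * α (dist x y)))
      (tendsto_atTop_add_const_left _ _
        ((hα.tendsto_atTop.comp (tendsto_dist_left_cocompact_atTop x)).const_mul_atTop ht))
  exact ⟨y, le_antisymm (QInf_le hα ht.le hM x y) (le_ciInf hy)⟩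

theorem abs_QInf_le (hα : IsYoung α) (ht : 0 ≤ t) (hM : ∀ x, |g x| ≤ M) (x : X) :
    |QInf α t g x| ≤ M := by
  have : Nonempty X := ⟨x⟩
  refine abs_le.2 ⟨le_ciInf fun y => ?_, ?_⟩
  · have := (abs_le.1 (hM y)).1
    have := mul_nonneg ht (hα.nonneg (dist x y))
    linarith
  · have := QInf_le hα ht hM x x
    rw [dist_self, hα.zero] at this
    linarith [(abs_le.1 (hM x)).2]

/-- Comparison of the inf-convolution at `x'` with its value at `x`, where it is attained at `y`. -/
theorem QInf_sub_le (hα : IsYoung α) (ht : 0 ≤ t) (hM : ∀ x, |g x| ≤ M) {x y : X}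
    (hy : QInf α t g x = g y + t * α (dist x y)) (x' : X) :
    QInf α t g x' - QInf α t g x ≤ t * (α (dist x y + dist x' x) - α (dist x y)) := by
  have h1 := QInf_le hα ht hM x' y
  have h2 : α (dist x' y) ≤ α (dist x y + dist x' x) :=
    hα.le_of_le dist_nonneg (by linarith [dist_triangle x' x y])
  have h3 := mul_le_mul_of_nonneg_left h2 ht
  rw [hy]
  linarith

theorem locallyLipschitz_QInf [ProperSpace X] (hα : IsYoung α) (ht : 0 < t) (hg : Continuous g)
    (hM : ∀ x, |g x| ≤ M) : LocallyLipschitz (QInf α t g) := by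
  obtain ⟨R, hR⟩ := eventually_atTop.1 (hα.tendsto_atTop.eventually_gt_atTop (2 * M / t))
  have hstep : ∀ x x' : X, dist x' x ≤ 1 →
      QInf α t g x' - QInf α t g x ≤ t * rightD α (R + 1) * dist x' x := by
    intro x x' hd
    obtain ⟨y, hy⟩ := exists_QInf_eq hα ht hg hM x
    have hyR : dist x y ≤ R := by
      by_contra! h
      have h1 := hR _ h.le
      rw [div_lt_iff₀' ht] at h1
      linarith [(abs_le.1 (hM y)).1, (abs_le.1 (abs_QInf_le hα ht.le hM x)).2]
    have h1 := hα.add_rightD_mul_le (dist x y + dist x' x) (dist x y)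
    have h2 : rightD α (dist x y + dist x' x) ≤ rightD α (R + 1) := hα.rightD_mono (by linarith)
    have h3 := mul_le_mul_of_nonneg_right h2 (dist_nonneg (x := x') (y := x))
    refine (QInf_sub_le hα ht.le hM hy x').trans ?_
    rw [mul_assoc]
    gcongr
    linarith
  intro x
  refine ⟨(t * rightD α (R + 1)).toNNReal, Metric.ball x (1 / 2),
    Metric.ball_mem_nhds x (by norm_num), LipschitzOnWith.of_dist_le_mul fun a ha b hb => ?_⟩
  have hab : dist a b ≤ 1 := by
    have := dist_triangle_right a b x
    rw [Metric.mem_ball] at ha hb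
    linarith
  have hK : t * rightD α (R + 1) * dist a b ≤ (t * rightD α (R + 1)).toNNReal * dist a b := by
    gcongr
    exact Real.le_coe_toNNReal _
  refine le_trans ?_ hK
  have h1 := hstep b a hab
  have h2 := hstep a b (dist_comm a b ▸ hab)
  rw [dist_comm b a] at h2
  rw [Real.dist_eq, abs_le]
  constructor <;> linarith

theorem gradPlus_nonneg {f : X → ℝ} {x : X}
    (hf : IsBoundedUnder (· ≤ ·) (𝓝[≠] x) fun y => max (f y - f x) 0 / dist y x) :
    0 ≤ gradPlus f x := by
  rcases (𝓝[≠] x).eq_or_neBot with h | h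
  · simp [gradPlus, h, limsup_eq]
  · exact le_limsup_of_frequently_le
      (Frequently.of_forall fun y => div_nonneg (le_max_right _ _) dist_nonneg) hf

theorem eventually_quotient_QInf_le (hα : IsYoung α) (ht : 0 < t) (hM : ∀ x, |g x| ≤ M) {x y : X}
    (hy : QInf α t g x = g y + t * α (dist x y)) {ε : ℝ} (hε : 0 < ε) :
    ∀ᶠ x' in 𝓝[≠] x, max (QInf α t g x' - QInf α t g x) 0 / dist x' x ≤
      t * rightD α (dist x y) + ε := by
  have hmap : Tendsto (fun x' => dist x y + dist x' x) (𝓝[≠] x) (𝓝[>] (dist x y)) := by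
    refine tendsto_nhdsWithin_iff.2 ⟨?_, ?_⟩
    · have : Tendsto (fun x' => dist x y + dist x' x) (𝓝 x) (𝓝 (dist x y + dist x x)) :=
        Continuous.tendsto (by fun_prop) x
      rw [dist_self, add_zero] at this
      exact this.mono_left nhdsWithin_le_nhds
    · filter_upwards [self_mem_nhdsWithin] with x' hx'
      have := dist_pos.2 hx'
      rw [Set.mem_Ioi]
      linarith
  have hslope := (((hasDerivWithinAt_iff_tendsto_slope' self_notMem_Ioi).1
    (hα.hasDerivWithinAt (dist x y))).comp hmap).const_mul t
  filter_upwards [hslope.eventually_le_const (lt_add_of_pos_right _ hε), self_mem_nhdsWithin]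
    with x' h1 hx'
  have hd : 0 < dist x' x := dist_pos.2 hx'
  refine le_trans ?_ h1
  rw [Function.comp_apply, slope_def_field, add_sub_cancel_left, ← mul_div_assoc]
  gcongr
  refine max_le (QInf_sub_le hα ht.le hM hy x') (mul_nonneg ht.le (sub_nonneg.2 ?_))
  exact hα.le_of_le dist_nonneg (by linarith)

theorem gradPlus_QInf_nonneg (hα : IsYoung α) (ht : 0 < t) (hM : ∀ x, |g x| ≤ M) {x y : X}
    (hy : QInf α t g x = g y + t * α (dist x y)) : 0 ≤ gradPlus (QInf α t g) x :=
  gradPlus_nonneg ⟨_, eventually_map.2 (eventually_quotient_QInf_le hα ht hM hy one_pos)⟩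

theorem gradPlus_QInf_le (hα : IsYoung α) (ht : 0 < t) (hM : ∀ x, |g x| ≤ M) {x y : X}
    (hy : QInf α t g x = g y + t * α (dist x y)) :
    gradPlus (QInf α t g) x ≤ t * rightD α (dist x y) := by
  rcases (𝓝[≠] x).eq_or_neBot with h | h
  · simpa [gradPlus, h, limsup_eq] using mul_nonneg ht.le (hα.rightD_nonneg dist_nonneg)
  · refine le_of_forall_pos_le_add fun ε hε => limsup_le_of_le ?_
      (eventually_quotient_QInf_le hα ht hM hy hε)
    exact isCoboundedUnder_le_of_le _ fun x' => div_nonneg (le_max_right _ _) dist_nonneg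

theorem QInf_mul_sub_le (hα : IsYoung α) (ht : 0 < t) {f : X → ℝ}
    (hM : ∀ x, |f x| ≤ M) {k : ℝ} (k' : ℝ) {x y : X}
    (hy : QInf α t (fun z => k * f z) x = k * f y + t * α (dist x y)) :
    QInf α t (fun z => k' * f z) x ≤ QInf α t (fun z => k * f z) x + (k' - k) * f y := by
  have := QInf_le hα ht.le (M := |k'| * M) (g := fun z => k' * f z)
    (fun z => by rw [abs_mul]; exact mul_le_mul_of_nonneg_left (hM z) (abs_nonneg _)) x y
  rw [hy]
  linarith

end InfConvolution

/-- A real function whose increments are bounded above by a multiple of the square of the step does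
not increase. -/
theorem le_of_forall_le_add_mul_sq {G : ℝ → ℝ} {a b C δ : ℝ} (hab : a < b) (hδ : 0 < δ)
    (hG : ∀ x y, a ≤ x → x < y → y - x ≤ δ → G y ≤ G x + C * (y - x) ^ 2) : G b ≤ G a := by
  have hsum : ∀ n : ℕ, (b - a) / (n + 1) ≤ δ → G b ≤ G a + C * (b - a) ^ 2 / (n + 1) := by
    intro n hn
    set s := (b - a) / (n + 1) with hs
    have hs0 : 0 < s := div_pos (sub_pos.2 hab) (by positivity)
    have hi : ∀ i : ℕ, G (a + i * s) ≤ G a + i * (C * s ^ 2) := by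
      intro i
      induction i with
      | zero => simp
      | succ i ih =>
        have h1 : a + ((i + 1 : ℕ) : ℝ) * s - (a + i * s) = s := by push_cast; ring
        have h2 := hG (a + i * s) (a + ((i + 1 : ℕ) : ℝ) * s)
          (le_add_of_nonneg_right (by positivity)) (by linarith) (by linarith)
        rw [h1] at h2
        push_cast at h2 ⊢
        linarith
    have h := hi (n + 1)
    have hb : a + ((n + 1 : ℕ) : ℝ) * s = b := by
      rw [hs]; push_cast; field_simp; ring
    have hC : ((n + 1 : ℕ) : ℝ) * (C * s ^ 2) = C * (b - a) ^ 2 / (n + 1) := by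
      rw [hs]; push_cast; field_simp
    rwa [hb, hC] at h
  have hlim : ∀ c : ℝ, Tendsto (fun n : ℕ => c / ((n : ℝ) + 1)) atTop (𝓝 0) := fun c =>
    tendsto_const_nhds.div_atTop
      (tendsto_atTop_add_const_right _ _ tendsto_natCast_atTop_atTop)
  have := (hlim (C * (b - a) ^ 2)).const_add (G a)
  rw [add_zero] at this
  exact ge_of_tendsto this (((hlim (b - a)).eventually_le_const hδ).mono hsum)

section Herbst

variable {X : Type*} [MetricSpace X] [ProperSpace X] [MeasurableSpace X] [BorelSpace X]
  {α : ℝ → ℝ} {t M A : ℝ} {f : X → ℝ} {μ : Measure X} [IsProbabilityMeasure μ]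

/-- The log-Sobolev inequality applied to an inf-convolution, the cost of the optimal displacement
being bounded by a difference quotient in the parameter `k`. -/
theorem LSIplus.mul_integral_QInf_sub_le (hLSI : LSIplus μ α A) (hα : IsYoung α) (hA : 0 < A)
    (ht : 0 < t) (hξ : xiAlpha α t ≤ ENNReal.ofReal (1 / A)) (hf : Continuous f)
    (hM : ∀ x, |f x| ≤ M) {k k' : ℝ} (hk : 0 ≤ k) (hkk' : k < k')
    {p p' : X → ℝ} (hp : p = QInf α t fun z => k * f z) (hp' : p' = QInf α t fun z => k' * f z) :
    k * ∫ x, (p' x - p x) * Real.exp (p x) ∂μ ≤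
      (k' - k) * ((∫ x, Real.exp (p x) ∂μ) * Real.log (∫ x, Real.exp (p x) ∂μ)) := by
  have hkM : ∀ r : ℝ, ∀ x, |r * f x| ≤ |r| * M := fun r x => by
    rw [abs_mul]; exact mul_le_mul_of_nonneg_left (hM x) (abs_nonneg _)
  have hkf : ∀ r : ℝ, Continuous fun x => r * f x := fun r => by fun_prop
  have hlip : LocallyLipschitz p := hp ▸ locallyLipschitz_QInf hα ht (hkf k) (hkM k)
  have hcp : Continuous p := hlip.continuous
  have hcp' : Continuous p' :=
    (hp' ▸ locallyLipschitz_QInf hα ht (hkf k') (hkM k') : LocallyLipschitz p').continuous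
  have hbp : ∀ x, |p x| ≤ |k| * M := fun x => hp ▸ abs_QInf_le hα ht.le (hkM k) x
  have hbp' : ∀ x, |p' x| ≤ |k'| * M := fun x => hp' ▸ abs_QInf_le hα ht.le (hkM k') x
  have hexp : ∀ x, Real.exp (p x) ≤ Real.exp (|k| * M) := fun x =>
    Real.exp_le_exp.2 (abs_le.1 (hbp x)).2
  have hint : ∀ {q : X → ℝ} {C : ℝ}, Continuous q → (∀ x, |q x| ≤ C) →
      Integrable (fun x => q x * Real.exp (p x)) μ := by
    intro q C hq hC
    refine Integrable.of_bound (by fun_prop : Continuous _).aestronglyMeasurable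
      (C * Real.exp (|k| * M)) (ae_of_all _ fun x => ?_)
    rw [norm_mul, Real.norm_of_nonneg (Real.exp_pos _).le]
    exact mul_le_mul (hC x) (hexp x) (Real.exp_pos _).le ((abs_nonneg _).trans (hC x))
  have hip := hint hcp hbp
  have hip' := hint hcp' hbp'
  have hd : 0 < k' - k := sub_pos.2 hkk'
  set W : X → ℝ := fun x => p x - k * (p' x - p x) / (k' - k) with hW
  have hWeq : ∀ x, W x * Real.exp (p x) = p x * Real.exp (p x) -
      k / (k' - k) * (p' x * Real.exp (p x) - p x * Real.exp (p x)) := fun x => by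
    simp only [hW]; ring
  have hisub : Integrable (fun x => p' x * Real.exp (p x) - p x * Real.exp (p x)) μ :=
    hip'.sub hip
  have hWint : Integrable (fun x => W x * Real.exp (p x)) μ := by
    simp_rw [hWeq]
    exact hip.sub (hisub.const_mul _)
  have hmin : ∀ x, ∃ y, p x = k * f y + t * α (dist x y) ∧ t * α (dist x y) ≤ W x := by
    intro x
    obtain ⟨y, hy⟩ := exists_QInf_eq hα ht (hkf k) (hkM k) x
    have h1 := QInf_mul_sub_le hα ht hM k' hy
    rw [← hp, ← hp'] at h1
    rw [← hp] at hy
    refine ⟨y, hy, ?_⟩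
    have h2 : k * (p' x - p x) / (k' - k) ≤ k * f y := by
      rw [div_le_iff₀ hd, mul_assoc]
      refine mul_le_mul_of_nonneg_left ?_ hk
      linarith
    simp only [hW]
    linarith
  have hW0 : ∀ x, 0 ≤ W x := fun x => by
    obtain ⟨y, -, hy⟩ := hmin x
    exact (mul_nonneg ht.le (hα.nonneg _)).trans hy
  have hWe0 : 0 ≤ ∫ x, W x * Real.exp (p x) ∂μ :=
    integral_nonneg fun x => mul_nonneg (hW0 x) (Real.exp_pos _).le
  have hkey : entExp μ p ≤ ∫ x, W x * Real.exp (p x) ∂μ := by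
    rw [← ENNReal.ofReal_le_ofReal_iff hWe0]
    refine (hLSI p ⟨_, hbp⟩ hlip).trans ?_
    calc ENNReal.ofReal A *
          ∫⁻ x, legendre α (gradPlus p x) * ENNReal.ofReal (Real.exp (p x)) ∂μ
        ≤ ENNReal.ofReal A *
          ∫⁻ x, ENNReal.ofReal (1 / A * (W x * Real.exp (p x))) ∂μ := by
          gcongr with x
          obtain ⟨y, hy, hyW⟩ := hmin x
          rw [hp] at hy
          rw [← mul_assoc, ENNReal.ofReal_mul (mul_nonneg (by positivity) (hW0 x)),
            ENNReal.ofReal_mul (by positivity)]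
          gcongr
          rw [hp]
          refine (hα.legendre_mono (gradPlus_QInf_nonneg hα ht (hkM k) hy)
            (gradPlus_QInf_le hα ht (hkM k) hy)).trans ?_
          refine (hα.legendre_mul_rightD_le ht hξ dist_nonneg).trans ?_
          gcongr
      _ = ENNReal.ofReal (∫ x, W x * Real.exp (p x) ∂μ) := by
          rw [← ofReal_integral_eq_lintegral_ofReal (hWint.const_mul _)
            (ae_of_all _ fun x => mul_nonneg (by positivity)
              (mul_nonneg (hW0 x) (Real.exp_pos _).le)),
            integral_const_mul, ← ENNReal.ofReal_mul hA.le]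
          congr 1
          field_simp
  have hWsplit : ∫ x, W x * Real.exp (p x) ∂μ = ∫ x, p x * Real.exp (p x) ∂μ -
      k / (k' - k) * ∫ x, (p' x - p x) * Real.exp (p x) ∂μ := by
    simp_rw [hWeq, sub_mul]
    rw [integral_sub hip (hisub.const_mul _), integral_const_mul]
  have hent : entExp μ p = ∫ x, p x * Real.exp (p x) ∂μ -
      (∫ x, Real.exp (p x) ∂μ) * Real.log (∫ x, Real.exp (p x) ∂μ) := by
    simp only [entExp, Real.log_exp, mul_comm (Real.exp _)]
  rw [hWsplit, hent] at hkey
  have h1 : k / (k' - k) * ∫ x, (p' x - p x) * Real.exp (p x) ∂μ ≤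
      (∫ x, Real.exp (p x) ∂μ) * Real.log (∫ x, Real.exp (p x) ∂μ) := by linarith
  rwa [div_mul_eq_mul_div, div_le_iff₀' hd] at h1

/-- Dual form of the transport-entropy inequality, by monotonicity of
`k ↦ k⁻¹ log ∫ exp (inf_y {k f(y) + t α(d(x,y))}) dμ`. -/
theorem LSIplus.log_integral_exp_QInf_le (hLSI : LSIplus μ α A) (hα : IsYoung α) (hA : 0 < A)
    (ht : 0 < t) (hξ : xiAlpha α t ≤ ENNReal.ofReal (1 / A)) (hf : Continuous f)
    (hM : ∀ x, |f x| ≤ M) :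
    Real.log (∫ x, Real.exp (QInf α t f x) ∂μ) ≤ ∫ x, f x ∂μ := by
  obtain ⟨x₀⟩ : Nonempty X := nonempty_of_isProbabilityMeasure μ
  have hM0 : 0 ≤ M := (abs_nonneg _).trans (hM x₀)
  have hkM : ∀ r : ℝ, ∀ x, |r * f x| ≤ |r| * M := fun r x => by
    rw [abs_mul]; exact mul_le_mul_of_nonneg_left (hM x) (abs_nonneg _)
  have hkf : ∀ r : ℝ, Continuous fun x => r * f x := fun r => by fun_prop
  let p : ℝ → X → ℝ := fun k => QInf α t fun z => k * f z
  have hcp : ∀ k, Continuous (p k) := fun k =>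
    (locallyLipschitz_QInf hα ht (hkf k) (hkM k)).continuous
  have hbp : ∀ k x, |p k x| ≤ |k| * M := fun k x => abs_QInf_le hα ht.le (hkM k) x
  have hintb : ∀ {q : X → ℝ} {C : ℝ}, Continuous q → (∀ x, |q x| ≤ C) → Integrable q μ :=
    fun hq hC => Integrable.of_bound hq.aestronglyMeasurable _ (ae_of_all _ hC)
  have hexpint : ∀ {q : X → ℝ} {C : ℝ}, Continuous q → (∀ x, |q x| ≤ C) →
      Integrable (fun x => Real.exp (q x)) μ := fun {q C} hq hC =>
    hintb (C := Real.exp C) (by fun_prop) fun x => by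
      rw [abs_of_pos (Real.exp_pos _)]
      exact Real.exp_le_exp.2 (abs_le.1 (hC x)).2
  let Z : ℝ → ℝ := fun k => ∫ x, Real.exp (p k x) ∂μ
  have hZ : ∀ k, 0 < Z k := fun k => integral_exp_pos (hexpint (hcp k) (hbp k))
  have hdiff : ∀ {k k' : ℝ}, k ≤ k' → ∀ x, |p k' x - p k x| ≤ (k' - k) * M := by
    intro k k' hkk' x
    obtain ⟨y, hy⟩ := exists_QInf_eq hα ht (hkf k) (hkM k) x
    obtain ⟨y', hy'⟩ := exists_QInf_eq hα ht (hkf k') (hkM k') x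
    have h1 : p k' x ≤ p k x + (k' - k) * f y := QInf_mul_sub_le hα ht hM k' hy
    have h2 : p k x ≤ p k' x + (k - k') * f y' := QInf_mul_sub_le hα ht hM k hy'
    have h3 := mul_le_mul_of_nonneg_left (abs_le.1 (hM y)).2 (sub_nonneg.2 hkk')
    have h4 := mul_le_mul_of_nonneg_left (abs_le.1 (hM y')).1 (sub_nonneg.2 hkk')
    rw [abs_le]
    constructor <;> linarith
  have hstep : ∀ k k' : ℝ, 0 < k → k < k' → k' - k ≤ 1 / (M + 1) →
      Real.log (Z k') / k' ≤ Real.log (Z k) / k + M ^ 2 / k' * (k' - k) ^ 2 := by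
    intro k k' hk hkk' hsmall
    have hk' := hk.trans hkk'
    have hd : 0 < k' - k := sub_pos.2 hkk'
    have hLS := hLSI.mul_integral_QInf_sub_le hα hA ht hξ hf hM hk.le hkk' (p := p k) (p' := p k')
      rfl rfl
    have hsm : (k' - k) * M ≤ 1 := by
      rw [le_div_iff₀ (by positivity)] at hsmall
      linarith
    have hI1 : Integrable (fun x => (p k' x - p k x) * Real.exp (p k x)) μ := by
      refine (hexpint (hcp k) (hbp k)).bdd_mul (c := (k' - k) * M)
        ((hcp k').sub (hcp k)).aestronglyMeasurable (ae_of_all _ fun x => hdiff hkk'.le x)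
    have hpt : ∀ x, Real.exp (p k' x) ≤ (p k' x - p k x) * Real.exp (p k x) +
        (1 + (M * (k' - k)) ^ 2) * Real.exp (p k x) := by
      intro x
      set a := p k' x - p k x with ha
      have hax : |a| ≤ (k' - k) * M := hdiff hkk'.le x
      have h1 := (abs_le.1 (Real.abs_exp_sub_one_sub_id_le (hax.trans hsm))).2
      have h2 : a ^ 2 ≤ (M * (k' - k)) ^ 2 := by
        rw [mul_comm M, ← sq_abs a]
        gcongr
      have h3 : Real.exp (p k' x) = Real.exp a * Real.exp (p k x) := by
        rw [← Real.exp_add, ha]; congr 1; ring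
      rw [h3, ← add_mul]
      gcongr
      linarith
    have hZ' : Z k' ≤ ∫ x, (p k' x - p k x) * Real.exp (p k x) ∂μ +
        (1 + (M * (k' - k)) ^ 2) * Z k := by
      have := integral_mono (hexpint (hcp k') (hbp k'))
        (hI1.add ((hexpint (hcp k) (hbp k)).const_mul (1 + (M * (k' - k)) ^ 2))) hpt
      simp only [Pi.add_apply] at this
      rwa [integral_add hI1 ((hexpint (hcp k) (hbp k)).const_mul _), integral_const_mul] at this
    have hLS' : ∫ x, (p k' x - p k x) * Real.exp (p k x) ∂μ ≤
        (k' - k) / k * (Z k * Real.log (Z k)) := by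
      rw [div_mul_eq_mul_div, le_div_iff₀' hk]
      exact hLS
    have hratio : Z k' / Z k ≤ (k' - k) / k * Real.log (Z k) + (1 + (M * (k' - k)) ^ 2) := by
      rw [div_le_iff₀ (hZ k)]
      linarith
    have hlog := Real.log_le_sub_one_of_pos (div_pos (hZ k') (hZ k))
    rw [Real.log_div (hZ k').ne' (hZ k).ne'] at hlog
    have hfin : Real.log (Z k') ≤ k' * (Real.log (Z k) / k) + (M * (k' - k)) ^ 2 := by
      have : k' * (Real.log (Z k) / k) = Real.log (Z k) + (k' - k) / k * Real.log (Z k) := by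
        field_simp; ring
      linarith
    rw [div_le_iff₀' hk']
    refine hfin.trans_eq ?_
    field_simp
  have hmono : ∀ k : ℝ, 0 < k → k < 1 → Real.log (Z 1) / 1 ≤ Real.log (Z k) / k := by
    intro k hk hk1
    refine le_of_forall_le_add_mul_sq (G := fun r => Real.log (Z r) / r) (C := M ^ 2 / k) hk1
      (show 0 < 1 / (M + 1) by positivity) fun x y hx hxy hδ => ?_
    refine (hstep x y (hk.trans_le hx) hxy hδ).trans ?_
    gcongr
    linarith
  have hsmall : ∀ k : ℝ, 0 < k → k < 1 → k * M ≤ 1 →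
      Real.log (Z 1) ≤ ∫ x, f x ∂μ + k * M ^ 2 := by
    intro k hk hk1 hkM1
    have hfi : Integrable f μ := hintb hf hM
    have hle : Z k ≤ 1 + (k * ∫ x, f x ∂μ + (k * M) ^ 2) := by
      have := integral_mono (hexpint (hcp k) (hbp k))
        ((integrable_const (1 + (k * M) ^ 2)).add (hfi.const_mul k)) fun x => by
          have h0 := QInf_le hα ht.le (hkM k) x x
          rw [dist_self, hα.zero, mul_zero, add_zero] at h0
          have hax : |k * f x| ≤ k * M := (hkM k x).trans_eq (by rw [abs_of_pos hk])
          have h1 := (abs_le.1 (Real.abs_exp_sub_one_sub_id_le (hax.trans hkM1))).2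
          have h2 : (k * f x) ^ 2 ≤ (k * M) ^ 2 := by
            rw [← sq_abs]
            gcongr
          have h3 : Real.exp (p k x) ≤ Real.exp (k * f x) := Real.exp_le_exp.2 h0
          simp only [Pi.add_apply]
          linarith
      simp only [Pi.add_apply] at this
      rw [integral_add (integrable_const _) (hfi.const_mul k), integral_const_mul,
        integral_const, probReal_univ, one_smul] at this
      change Z k ≤ _ at this
      linarith
    have h1 := hmono k hk hk1
    rw [div_one, le_div_iff₀' hk] at h1
    have h2 := Real.log_le_sub_one_of_pos (hZ k)
    refine le_of_mul_le_mul_left (a := k) ?_ hk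
    linarith
  have hZ1 : Z 1 = ∫ x, Real.exp (QInf α t f x) ∂μ := by simp [Z, p]
  rw [← hZ1]
  have hlim : Tendsto (fun k : ℝ => ∫ x, f x ∂μ + k * M ^ 2) (𝓝[>] 0) (𝓝 (∫ x, f x ∂μ)) := by
    have : Tendsto (fun k : ℝ => ∫ x, f x ∂μ + k * M ^ 2) (𝓝 0)
        (𝓝 (∫ x, f x ∂μ + 0 * M ^ 2)) := Continuous.tendsto (by fun_prop) 0
    rw [zero_mul, add_zero] at this
    exact this.mono_left nhdsWithin_le_nhds
  refine ge_of_tendsto hlim ?_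
  filter_upwards [Ioo_mem_nhdsGT (show (0 : ℝ) < 1 / (M + 1) by positivity)] with k hk
  have hk1 := (lt_div_iff₀ (by positivity)).1 hk.2
  have hkM' : 0 ≤ k * M := mul_nonneg hk.1.le hM0
  exact hsmall k hk.1 (by linarith) (by linarith [hk.1])

end Herbst

/-- The Donsker-Varadhan inequality. -/
theorem integral_le_integral_llr_add_log_integral_exp {Y : Type*} [MeasurableSpace Y]
    {ν μ : Measure Y} [IsProbabilityMeasure ν] [IsProbabilityMeasure μ] (hνμ : ν ≪ μ)
    (hint : Integrable (llr ν μ) ν) {g : Y → ℝ} (hg : Integrable g ν)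
    (hexp : Integrable (fun x => Real.exp (g x)) μ) :
    ∫ x, g x ∂ν ≤ ∫ x, llr ν μ x ∂ν + Real.log (∫ x, Real.exp (g x) ∂μ) := by
  have := isProbabilityMeasure_tilted hexp
  have h1 := InformationTheory.integral_llr_add_sub_measure_univ_nonneg
    (hνμ.trans (absolutelyContinuous_tilted hexp)) (integrable_llr_tilted_right hνμ hg hint hexp)
  rw [integral_llr_tilted_right hνμ hg hexp hint, probReal_univ, probReal_univ] at h1
  linarith

/-- The transport-entropy inequality for a fixed `t` with `ξ_α(t) ≤ 1 / A`. -/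
theorem LSIplus.transportCost_le {X : Type*} [MetricSpace X] [ProperSpace X] [MeasurableSpace X]
    [BorelSpace X] {α : ℝ → ℝ} {t A : ℝ} {μ ν : Measure X} [IsProbabilityMeasure μ]
    [IsProbabilityMeasure ν] (hLSI : LSIplus μ α A) (hα : IsYoung α) (hA : 0 < A) (ht : 0 < t)
    (hξ : xiAlpha α t ≤ ENNReal.ofReal (1 / A)) (hνμ : ν ≪ μ) (hint : Integrable (llr ν μ) ν) :
    ENNReal.ofReal t * transportCost α ν μ ≤ ENNReal.ofReal (∫ x, llr ν μ x ∂ν) := by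
  have hc := hα.continuous
  obtain ⟨π, h1, h2, hπ⟩ := exists_coupling_of_dual_le ν μ
    (c := fun z : X × X => t * α (dist z.1 z.2)) (by fun_prop)
    (fun z => mul_nonneg ht.le (hα.nonneg _)) (∫ x, llr ν μ x ∂ν) fun g h hgh => by
      set f : X → ℝ := fun y => -h y with hfdef
      have hfc : Continuous f := by fun_prop
      have hM : ∀ x, |f x| ≤ ‖h‖ := fun x => by
        simpa [hfdef] using h.norm_coe_le_norm x
      have hQc : Continuous (QInf α t f) := (locallyLipschitz_QInf hα ht hfc hM).continuous
      have hQb := abs_QInf_le hα ht.le hM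
      have hQint : Integrable (QInf α t f) ν :=
        Integrable.of_bound hQc.aestronglyMeasurable _ (ae_of_all _ hQb)
      have hexp : Integrable (fun x => Real.exp (QInf α t f x)) μ :=
        Integrable.of_bound (Real.continuous_exp.comp hQc).aestronglyMeasurable (Real.exp ‖h‖)
          (ae_of_all _ fun x => by
            rw [Real.norm_of_nonneg (Real.exp_pos _).le]
            exact Real.exp_le_exp.2 (abs_le.1 (hQb x)).2)
      have hgQ : ∫ x, g x ∂ν ≤ ∫ x, QInf α t f x ∂ν :=
        integral_mono (g.integrable ν) hQint fun x => by
          have : Nonempty X := ⟨x⟩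
          refine le_ciInf fun y => ?_
          have := hgh x y
          simp only [hfdef]
          linarith
      have hDV := integral_le_integral_llr_add_log_integral_exp hνμ hint hQint hexp
      have hdual := hLSI.log_integral_exp_QInf_le hα hA ht hξ hfc hM
      rw [integral_neg] at hdual
      linarith
  refine le_trans ?_ hπ
  calc ENNReal.ofReal t * transportCost α ν μ
      ≤ ENNReal.ofReal t * ∫⁻ z, ENNReal.ofReal (α (dist z.1 z.2)) ∂π := by
        gcongr
        exact sInf_le ⟨π, h1, h2, rfl⟩
    _ = ∫⁻ z, ENNReal.ofReal (t * α (dist z.1 z.2)) ∂π := by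
        simp_rw [ENNReal.ofReal_mul ht.le]
        rw [lintegral_const_mul _ (by fun_prop)]

theorem lsi_plus_implies_transport_entropy_tA
    {X : Type*} [MetricSpace X] [CompleteSpace X] [TopologicalSpace.SeparableSpace X]
    [ProperSpace X] [MeasurableSpace X] [BorelSpace X]
    (α : ℝ → ℝ) (hα : IsYoung α) (hΔ : DeltaTwo α)
    (μ : Measure X) [IsProbabilityMeasure μ] (A : ℝ) (hA : 0 < A)
    (hLSI : LSIplus μ α A) :
    TransportEntropy μ α
      (1 / sSup {t : ℝ | 0 ≤ t ∧ xiAlpha α t < ENNReal.ofReal (1 / A)}) := by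
  set S := {t : ℝ | 0 ≤ t ∧ xiAlpha α t < ENNReal.ofReal (1 / A)} with hS
  have hA' : 0 < 1 / A := by positivity
  have hbdd : BddAbove S := by
    refine ⟨α (1 / A + 1) / α 1, fun t ht => ?_⟩
    rcases ht.1.eq_or_lt with h | h
    · rw [← h]
      exact div_nonneg (hα.nonneg _) (hα.nonneg _)
    · exact hα.le_of_xiAlpha_le h hA'.le ht.2.le
  obtain ⟨t₀, ht₀, hξ₀⟩ := hα.exists_xiAlpha_le hΔ (half_pos hA')
  have ht₀S : t₀ ∈ S :=
    ⟨ht₀.le, hξ₀.trans_lt ((ENNReal.ofReal_lt_ofReal_iff hA').2 (half_lt_self hA'))⟩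
  have hpos : 0 < sSup S := ht₀.trans_le (le_csSup hbdd ht₀S)
  intro ν _
  by_cases hν : ν ≪ μ ∧ Integrable (fun x => Real.log (ν.rnDeriv μ x).toReal) ν
  · have hle := fun t (ht : 0 < t) (htS : t ∈ S) =>
      hLSI.transportCost_le hα hA ht htS.2.le hν.1 hν.2
    have hrel : relEnt ν μ = ENNReal.ofReal (∫ x, llr ν μ x ∂ν) := if_pos hν
    set I := ∫ x, llr ν μ x ∂ν with hI
    have hI0 : 0 ≤ I := by
      have := InformationTheory.integral_llr_add_sub_measure_univ_nonneg hν.1 hν.2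
      rwa [probReal_univ, probReal_univ, add_sub_cancel_right] at this
    have hfin : transportCost α ν μ ≠ ⊤ := fun h => by
      have := hle t₀ ht₀ ht₀S
      rw [h, ENNReal.mul_top (by simpa using ht₀)] at this
      exact ENNReal.ofReal_ne_top (top_le_iff.1 this)
    obtain ⟨T, hT⟩ : ∃ T, transportCost α ν μ = ENNReal.ofReal T ∧ 0 ≤ T :=
      ⟨_, (ENNReal.ofReal_toReal hfin).symm, ENNReal.toReal_nonneg⟩
    have hreal : ∀ t ∈ S, t * T ≤ I := fun t ht => by
      rcases ht.1.eq_or_lt with h | h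
      · rw [← h, zero_mul]
        exact hI0
      · have := hle t h ht
        rwa [hT.1, ← ENNReal.ofReal_mul h.le, ENNReal.ofReal_le_ofReal_iff hI0] at this
    have hsup : sSup S * T ≤ I := by
      rcases hT.2.eq_or_lt with h | h
      · rwa [← h, mul_zero]
      · rw [← le_div_iff₀ h]
        exact csSup_le ⟨t₀, ht₀S⟩ fun t ht => (le_div_iff₀ h).2 (hreal t ht)
    rw [hrel, hT.1, ← ENNReal.ofReal_mul (by positivity)]
    refine ENNReal.ofReal_le_ofReal ?_
    rw [one_div_mul_eq_div, le_div_iff₀' hpos]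
    exact hsup
  · have hrel : relEnt ν μ = ⊤ := if_neg hν
    rw [hrel, ENNReal.mul_top (by simpa using hpos)]
    exact le_top
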